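/- Let G be a graph with n vertices, (G,p) a framework in R^n (i.e., p assigns to each vertex a point of R^n). Then (G,p) admits a nonzero positive semidefinite equilibrium stress matrix if and only if the edge-length measurement π(Gram(p)) lies on the boundary of the convex cone k = π(PSD_n), where π : Sym_n → R^{E(G)} maps a symmetric matrix X to (X_{ii} + X_{jj} − 2X_{ij})_{ij ∈ E(G)}. Equivalently, (G,p) is liftable to an (n−1)-dimensional framework with full affine span if and only if it has no nonzero PSD equilibrium stress. -/

import Mathlib

open Matrix

/-- The Gram matrix of a configuration of `n` points in `ℝⁿ`. -/
noncomputable def gramOf (n : ℕ) (p : Fin n → Fin n → ℝ) : Matrix (Fin n) (Fin n) ℝ :=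
  Matrix.of fun i j => ∑ k, p i k * p j k

/-- The squared-edge-length measurement map `π : Symₙ → ℝ^{E(G)}`,
`X ↦ (X_{ii} + X_{jj} - 2 X_{ij})_{ij ∈ E(G)}` (written symmetrically in `i,j`). -/
noncomputable def edgeMeasure (n : ℕ) (G : SimpleGraph (Fin n))
    (X : Matrix (Fin n) (Fin n) ℝ) : G.edgeSet → ℝ := fun e =>
  Sym2.lift ⟨fun i j => X i i + X j j - X i j - X j i, fun i j => by ring⟩ e.1

/-- `Ω` is a nonzero PSD equilibrium stress matrix of the framework `(G,p)`. -/
def IsNzPSDStressMatrix (n : ℕ) (G : SimpleGraph (Fin n)) (p : Fin n → Fin n → ℝ)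
    (Ω : Matrix (Fin n) (Fin n) ℝ) : Prop :=
  Ω ≠ 0 ∧ Ω.PosSemidef ∧ (∀ i j, i ≠ j → ¬ G.Adj i j → Ω i j = 0) ∧
  (∀ i, ∑ j, Ω i j = 0) ∧ (∀ i, ∑ j, Ω i j • p j = 0)

/-- The Gram matrix of a configuration of `n` points in `ℝᵐ`. -/
noncomputable def rowGram {n m : ℕ} (q : Fin n → Fin m → ℝ) : Matrix (Fin n) (Fin n) ℝ :=
  Matrix.of fun i j => ∑ k, q i k * q j k

lemma rowGram_posSemidef {n m : ℕ} (q : Fin n → Fin m → ℝ) : (rowGram q).PosSemidef := by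
  have h : rowGram q = Matrix.of q * (Matrix.of q)ᴴ := by
    ext i j
    simp [rowGram, Matrix.mul_apply]
  rw [h]
  exact Matrix.posSemidef_self_mul_conjTranspose _

lemma edgeMeasure_mk {n : ℕ} {G : SimpleGraph (Fin n)} (X : Matrix (Fin n) (Fin n) ℝ)
    {i j : Fin n} (h : G.Adj i j) :
    edgeMeasure n G X ⟨s(i, j), h⟩ = X i i + X j j - X i j - X j i := rfl

lemma edgeMeasure_ext {n : ℕ} {G : SimpleGraph (Fin n)} {y z : G.edgeSet → ℝ}
    (h : ∀ i j (hij : G.Adj i j), y ⟨s(i, j), hij⟩ = z ⟨s(i, j), hij⟩) : y = z := by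
  funext ⟨e, he⟩
  induction e using Sym2.ind with
  | _ i j => exact h i j he

/-- `edgeMeasure` as a linear map on all square matrices. -/
noncomputable def edgeMeasureLinear (n : ℕ) (G : SimpleGraph (Fin n)) :
    Matrix (Fin n) (Fin n) ℝ →ₗ[ℝ] (G.edgeSet → ℝ) where
  toFun := edgeMeasure n G
  map_add' X Y := edgeMeasure_ext fun i j h => by
    simp only [edgeMeasure_mk, Matrix.add_apply, Pi.add_apply]; ring
  map_smul' c X := edgeMeasure_ext fun i j h => by
    simp only [edgeMeasure_mk, Matrix.smul_apply, Pi.smul_apply, smul_eq_mul, RingHom.id_apply]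
    ring

lemma edgeMeasureLinear_apply {n : ℕ} {G : SimpleGraph (Fin n)} (X : Matrix (Fin n) (Fin n) ℝ) :
    edgeMeasureLinear n G X = edgeMeasure n G X := rfl

lemma edgeMeasureLinear_transpose {n : ℕ} {G : SimpleGraph (Fin n)}
    (X : Matrix (Fin n) (Fin n) ℝ) : edgeMeasureLinear n G Xᵀ = edgeMeasureLinear n G X :=
  edgeMeasure_ext fun i j h => by
    simp only [edgeMeasureLinear_apply, edgeMeasure_mk, Matrix.transpose_apply]; ring

lemma edgeMeasureLinear_surjective (n : ℕ) (G : SimpleGraph (Fin n)) :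
    Function.Surjective (edgeMeasureLinear n G) := by
  classical
  intro y
  refine ⟨Matrix.of fun i j => if h : G.Adj i j then -(y ⟨s(i, j), h⟩) / 2 else 0, ?_⟩
  refine edgeMeasure_ext fun i j h => ?_
  have hs : (⟨s(j, i), h.symm⟩ : G.edgeSet) = ⟨s(i, j), h⟩ := Subtype.ext Sym2.eq_swap
  simp only [edgeMeasureLinear_apply, edgeMeasure_mk, Matrix.of_apply, h, h.symm, dif_pos,
    SimpleGraph.irrefl, dif_neg, not_false_eq_true, hs]
  ring

lemma rowGram_edge {n m : ℕ} (q : Fin n → Fin m → ℝ) (i j : Fin n) :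
    rowGram q i i + rowGram q j j - rowGram q i j - rowGram q j i = ∑ k, (q i k - q j k) ^ 2 := by
  simp only [rowGram, Matrix.of_apply, ← Finset.sum_add_distrib, ← Finset.sum_sub_distrib]
  exact Finset.sum_congr rfl fun k _ => by ring

/-- The pairing of a matrix with a Gram matrix is a sum of quadratic forms. -/
lemma sum_mul_rowGram {n m : ℕ} (Ω : Matrix (Fin n) (Fin n) ℝ) (q : Fin n → Fin m → ℝ) :
    ∑ i, ∑ j, Ω i j * rowGram q i j =
      ∑ k, star (fun i => q i k) ⬝ᵥ Ω *ᵥ (fun i => q i k) := by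
  simp only [rowGram, Matrix.of_apply, dotProduct, Matrix.mulVec, Finset.mul_sum, star_trivial]
  rw [Finset.sum_comm (s := (Finset.univ : Finset (Fin m)))]
  refine Finset.sum_congr rfl fun i _ => ?_
  rw [Finset.sum_comm]
  exact Finset.sum_congr rfl fun j _ => Finset.sum_congr rfl fun k _ => by ring

lemma mulVec_column_eq_zero {n m : ℕ} {Ω : Matrix (Fin n) (Fin n) ℝ} (hΩ : Ω.PosSemidef)
    {q : Fin n → Fin m → ℝ} (h : ∑ i, ∑ j, Ω i j * rowGram q i j = 0) (k : Fin m) :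
    Ω *ᵥ (fun i => q i k) = 0 := by
  rw [sum_mul_rowGram, Finset.sum_eq_zero_iff_of_nonneg
    fun k _ => hΩ.dotProduct_mulVec_nonneg _] at h
  exact (hΩ.dotProduct_mulVec_zero_iff _).1 (h k (Finset.mem_univ k))

lemma sum_mul_eq_edge {n : ℕ} {Ω : Matrix (Fin n) (Fin n) ℝ} (hs : Ω.IsHermitian)
    (h0 : ∀ i, ∑ j, Ω i j = 0) (X : Matrix (Fin n) (Fin n) ℝ) :
    ∑ i, ∑ j, Ω i j * (X i i + X j j - X i j - X j i) = -2 * ∑ i, ∑ j, Ω i j * X i j := by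
  have hs' (i j) : Ω i j = Ω j i := by simpa using (hs.apply i j).symm
  have h1 : ∑ i, ∑ j, Ω i j * X i i = 0 := by simp [← Finset.sum_mul, h0]
  have h2 : ∑ i, ∑ j, Ω i j * X j j = 0 := by
    rw [Finset.sum_comm]
    simp_rw [fun i j => hs' j i]
    exact h1
  have h3 : ∑ i, ∑ j, Ω i j * X j i = ∑ i, ∑ j, Ω i j * X i j := by
    rw [Finset.sum_comm]
    simp_rw [fun i j => hs' j i]
  simp only [mul_sub, mul_add, Finset.sum_sub_distrib, Finset.sum_add_distrib, h1, h2, h3]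
  ring

/-- A full-dimensional lift rules out a nonzero PSD stress matrix. -/
lemma not_stress_of_lift {n : ℕ} (hn : 1 ≤ n) {G : SimpleGraph (Fin n)} {p : Fin n → Fin n → ℝ}
    {pt : Fin n → Fin (n - 1) → ℝ}
    (hd : ∀ i j, G.Adj i j → ∑ k, (p i k - p j k) ^ 2 = ∑ k, (pt i k - pt j k) ^ 2)
    (hspan : affineSpan ℝ (Set.range pt) = ⊤) {Ω : Matrix (Fin n) (Fin n) ℝ}
    (hΩ : IsNzPSDStressMatrix n G p Ω) : False := by
  obtain ⟨hne, hpsd, hadj, hrow, heq⟩ := hΩ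
  have hmul : ∀ k, Ω *ᵥ (fun i => p i k) = 0 := fun k => by
    funext i
    simpa [Matrix.mulVec, dotProduct] using congrFun (heq i) k
  have hp : ∑ i, ∑ j, Ω i j * rowGram p i j = 0 := by
    simp [sum_mul_rowGram, hmul]
  have hpt : ∑ i, ∑ j, Ω i j * rowGram pt i j = 0 := by
    have e1 := sum_mul_eq_edge hpsd.isHermitian hrow (rowGram p)
    have e2 := sum_mul_eq_edge hpsd.isHermitian hrow (rowGram pt)
    have e3 : ∀ i j, Ω i j * ∑ k, (p i k - p j k) ^ 2 = Ω i j * ∑ k, (pt i k - pt j k) ^ 2 := by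
      intro i j
      by_cases hij : i = j
      · simp [hij]
      by_cases ha : G.Adj i j
      · rw [hd i j ha]
      · simp [hadj i j hij ha]
    simp only [rowGram_edge] at e1 e2
    simp only [e3] at e1
    linarith
  have hcard : Fintype.card (Fin n) = (n - 1) + 1 := by simp; omega
  have hind : AffineIndependent ℝ pt := by
    rw [affineIndependent_iff_finrank_vectorSpan_eq ℝ pt hcard, ← direction_affineSpan, hspan,
      AffineSubspace.direction_top, finrank_top, Module.finrank_fin_fun]
  refine hne ?_
  ext i j
  refine hind.eq_zero_of_sum_eq_zero (hrow i) ?_ j (Finset.mem_univ j)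
  funext k
  simpa [Matrix.mulVec, dotProduct] using congrFun (mulVec_column_eq_zero hpsd hpt k) i

open scoped MatrixOrder Matrix.Norms.L2Operator in
/-- A positive definite matrix is the Gram matrix of an affinely independent configuration, which
can be moved isometrically into `ℝⁿ⁻¹`. -/
lemma exists_config_of_posDef {n : ℕ} (hn : 1 ≤ n) {X : Matrix (Fin n) (Fin n) ℝ}
    (hX : X.PosDef) : ∃ pt : Fin n → Fin (n - 1) → ℝ,
      (∀ i j, X i i + X j j - X i j - X j i = ∑ k, (pt i k - pt j k) ^ 2) ∧
        affineSpan ℝ (Set.range pt) = ⊤ := by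
  obtain ⟨B, hB⟩ := CStarAlgebra.nonneg_iff_eq_star_mul_self.mp hX.posSemidef.nonneg
  set q : Fin n → EuclideanSpace ℝ (Fin n) := fun i => WithLp.toLp 2 fun k => B k i with hq
  have hXq (i j) : X i j = ∑ k, q i k * q j k := by
    rw [hB]; simp [Matrix.mul_apply, hq, Matrix.star_eq_conjTranspose]
  have hcard : Fintype.card (Fin n) = (n - 1) + 1 := by simp; omega
  have hind : AffineIndependent ℝ q := by
    rw [affineIndependent_iff]
    intro s w _ hw i hi
    by_contra hne
    set v : Fin n → ℝ := fun j => if j ∈ s then w j else 0 with hv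
    have hBv : B *ᵥ v = 0 := by
      funext k
      have h := congrArg (fun u : EuclideanSpace ℝ (Fin n) => u k) hw
      simpa [hq, hv, Matrix.mulVec, dotProduct, mul_comm] using h
    have hpos := hX.dotProduct_mulVec_pos (x := v) fun h => hne (by simpa [hv, hi] using congrFun h i)
    rw [hB, ← Matrix.mulVec_mulVec, hBv] at hpos
    simp at hpos
  set V := vectorSpan ℝ (Set.range q)
  have hdim : Module.finrank ℝ V = n - 1 := hind.finrank_vectorSpan hcard
  let L : V ≃ₗᵢ[ℝ] EuclideanSpace ℝ (Fin (n - 1)) :=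
    ((stdOrthonormalBasis ℝ V).reindex (finCongr hdim)).repr
  let o : Fin n := ⟨0, hn⟩
  let d : Fin n → V := fun i => ⟨q i - q o,
    vsub_mem_vectorSpan ℝ (Set.mem_range_self i) (Set.mem_range_self o)⟩
  have hcardtop : ∀ pt : Fin n → Fin (n - 1) → ℝ, AffineIndependent ℝ pt →
      affineSpan ℝ (Set.range pt) = ⊤ := fun pt h => by
    rw [h.affineSpan_eq_top_iff_card_eq_finrank_add_one, hcard]; simp
  refine ⟨fun i k => L (d i) k, fun i j => ?_, hcardtop _ ?_⟩
  · have h1 : ‖L (d i) - L (d j)‖ ^ 2 = ‖q i - q j‖ ^ 2 := by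
      rw [← map_sub, L.norm_map, Submodule.coe_norm]
      congr 2
      simp [d]
    rw [EuclideanSpace.real_norm_sq_eq, EuclideanSpace.real_norm_sq_eq] at h1
    simp only [PiLp.sub_apply] at h1
    rw [h1]
    simp only [hXq, ← Finset.sum_add_distrib, ← Finset.sum_sub_distrib]
    exact Finset.sum_congr rfl fun k _ => by ring
  · rw [affineIndependent_iff]
    intro s w hw hsum
    refine hind.eq_zero_of_sum_eq_zero hw ?_
    have h1 : L (∑ i ∈ s, w i • d i) = 0 := by
      ext k
      simpa using congrFun hsum k
    have h2 : ∑ i ∈ s, w i • d i = 0 := L.map_eq_zero_iff.1 h1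
    have h3 := congrArg (Subtype.val) h2
    simpa [d, smul_sub, Finset.sum_sub_distrib, ← Finset.sum_smul, hw] using h3

/-- An interior point of the cone `π(PSDₙ)` is the measurement of a positive definite matrix. -/
lemma exists_posDef_of_mem_interior {n : ℕ} {G : SimpleGraph (Fin n)} {x : G.edgeSet → ℝ}
    (hx : x ∈ interior (edgeMeasure n G '' {X : Matrix (Fin n) (Fin n) ℝ | X.PosSemidef})) :
    ∃ X : Matrix (Fin n) (Fin n) ℝ, X.PosDef ∧ edgeMeasure n G X = x := by
  have hcont : Filter.Tendsto (fun ε : ℝ => x - ε • edgeMeasureLinear n G 1)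
      (nhdsWithin 0 (Set.Ioi 0)) (nhds x) := by
    have : Continuous fun ε : ℝ => x - ε • edgeMeasureLinear n G 1 := by fun_prop
    have h := this.tendsto 0
    simp only [zero_smul, sub_zero] at h
    exact h.mono_left nhdsWithin_le_nhds
  have hev := hcont.eventually (mem_interior_iff_mem_nhds.1 hx)
  obtain ⟨ε, ⟨Y, hY, hYe⟩, hε⟩ := (hev.and self_mem_nhdsWithin).exists
  refine ⟨Y + ε • 1, Matrix.PosDef.posSemidef_add hY (Matrix.PosDef.one.smul hε), ?_⟩
  rw [← edgeMeasureLinear_apply, map_add, map_smul, edgeMeasureLinear_apply, hYe]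
  simp

/-- A supporting functional of a convex cone at a non-interior point. -/
lemma exists_supporting_functional {E : Type*} [NormedAddCommGroup E] [NormedSpace ℝ E]
    [FiniteDimensional ℝ E] {k : Set E} (hconv : Convex ℝ k)
    (hcone : ∀ y ∈ k, ∀ t : ℝ, 0 ≤ t → t • y ∈ k) {x : E} (hx : x ∈ k)
    (hxi : x ∉ interior k) :
    ∃ f : E →ₗ[ℝ] ℝ, f ≠ 0 ∧ f x = 0 ∧ ∀ y ∈ k, 0 ≤ f y := by
  have h0 : (0 : E) ∈ k := by simpa using hcone x hx 0 le_rfl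
  by_cases hspan : Submodule.span ℝ k = ⊤
  · have hint : (interior k).Nonempty := by
      rw [hconv.interior_nonempty_iff_affineSpan_eq_top,
        AffineSubspace.affineSpan_eq_top_iff_vectorSpan_eq_top_of_nonempty _ _ _ ⟨x, hx⟩,
        eq_top_iff, ← hspan, vectorSpan_def]
      exact Submodule.span_mono fun y hy => ⟨y, hy, 0, h0, by simp⟩
    obtain ⟨f, hf⟩ := geometric_hahn_banach_open_point hconv.interior isOpen_interior hxi
    have hle : ∀ y ∈ k, f y ≤ f x := by
      intro y hy
      have hy' : y ∈ closure (interior k) := by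
        rw [hconv.closure_interior_eq_closure_of_nonempty_interior hint]
        exact subset_closure hy
      exact closure_minimal (fun z hz => (hf z hz).le)
        (isClosed_le f.continuous continuous_const) hy'
    have hfx : f x = 0 := by
      have h1 := hle _ h0
      have h2 := hle _ (hcone x hx 2 (by norm_num))
      simp only [map_zero, map_smul, smul_eq_mul] at h1 h2
      linarith
    obtain ⟨z, hz⟩ := hint
    refine ⟨-(f : E →ₗ[ℝ] ℝ), fun h => ?_, by simp [hfx], fun y hy => ?_⟩
    · have h1 := hf z hz
      have h2 := LinearMap.congr_fun h z
      simp only [LinearMap.neg_apply, ContinuousLinearMap.coe_coe, LinearMap.zero_apply] at h2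
      linarith
    · have := hle y hy
      simp only [LinearMap.neg_apply, ContinuousLinearMap.coe_coe]
      linarith
  · obtain ⟨f, hf, hker⟩ := Submodule.exists_le_ker_of_lt_top _ (lt_top_iff_ne_top.2 hspan)
    have hz : ∀ y ∈ k, f y = 0 := fun y hy => hker (Submodule.subset_span hy)
    exact ⟨f, hf, hz x hx, fun y hy => (hz y hy).ge⟩

/-- A functional supporting the cone `π(PSDₙ)` at the measurement of `p` is a PSD stress. -/
lemma exists_stress_of_functional {n : ℕ} {G : SimpleGraph (Fin n)} {p : Fin n → Fin n → ℝ}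
    {f : (G.edgeSet → ℝ) →ₗ[ℝ] ℝ} (hf : f ≠ 0)
    (hfp : f (edgeMeasureLinear n G (rowGram p)) = 0)
    (hnn : ∀ X : Matrix (Fin n) (Fin n) ℝ, X.PosSemidef → 0 ≤ f (edgeMeasureLinear n G X)) :
    ∃ Ω, IsNzPSDStressMatrix n G p Ω := by
  set g : Matrix (Fin n) (Fin n) ℝ →ₗ[ℝ] ℝ := f ∘ₗ edgeMeasureLinear n G with hg
  set Ω : Matrix (Fin n) (Fin n) ℝ := Matrix.of fun i j => g (Matrix.single i j 1) with hΩ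
  have hsum : ∀ X, ∑ i, ∑ j, Ω i j * X i j = g X := by
    intro X
    conv_rhs => rw [Matrix.matrix_eq_sum_single X]
    simp only [map_sum]
    refine Finset.sum_congr rfl fun i _ => Finset.sum_congr rfl fun j _ => ?_
    have : Matrix.single i j (X i j) = X i j • Matrix.single i j (1 : ℝ) := by
      simp [Matrix.smul_single]
    rw [this, map_smul, smul_eq_mul, mul_comm, hΩ, Matrix.of_apply]
  have hpsd : Ω.PosSemidef := by
    refine .of_dotProduct_mulVec_nonneg ?_ fun v => ?_
    · ext i j
      simp only [Matrix.conjTranspose_apply, star_trivial, hΩ, Matrix.of_apply, hg,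
        LinearMap.comp_apply]
      rw [← edgeMeasureLinear_transpose, Matrix.transpose_single]
    · have h := hnn _ (Matrix.posSemidef_vecMulVec_self_star v)
      have h2 := hsum (Matrix.vecMulVec v (star v))
      rw [hg, LinearMap.comp_apply] at h2
      rw [← h2] at h
      refine h.trans_eq ?_
      simp only [dotProduct, Matrix.mulVec, Finset.mul_sum, Matrix.vecMulVec_apply, star_trivial]
      exact Finset.sum_congr rfl fun i _ => Finset.sum_congr rfl fun j _ => by ring
  refine ⟨Ω, fun h0 => hf ?_, hpsd, fun i j hij ha => ?_, fun i => ?_, fun i => ?_⟩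
  · refine LinearMap.ext fun y => ?_
    obtain ⟨X, rfl⟩ := edgeMeasureLinear_surjective n G y
    have h := hsum X
    rw [h0] at h
    simpa [hg] using h.symm
  · have : edgeMeasureLinear n G (Matrix.single i j 1) = 0 := by
      refine edgeMeasure_ext fun a b hab => ?_
      have h1 : ¬ (i = a ∧ j = a) := fun h => hij (h.1.trans h.2.symm)
      have h2 : ¬ (i = b ∧ j = b) := fun h => hij (h.1.trans h.2.symm)
      have h3 : ¬ (i = a ∧ j = b) := fun h => ha (h.1 ▸ h.2 ▸ hab)
      have h4 : ¬ (i = b ∧ j = a) := fun h => ha (h.1 ▸ h.2 ▸ hab.symm)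
      simp [edgeMeasureLinear_apply, edgeMeasure_mk, h1, h2, h3, h4]
    simp [hΩ, hg, this]
  · have h := hsum (Matrix.of fun a _ => if a = i then 1 else 0)
    have hz : edgeMeasureLinear n G (Matrix.of fun a _ => if a = i then 1 else 0) = 0 :=
      edgeMeasure_ext fun a b hab => by
        simp only [edgeMeasureLinear_apply, edgeMeasure_mk, Matrix.of_apply, Pi.zero_apply]
        ring
    rw [hg, LinearMap.comp_apply, hz, map_zero] at h
    simpa [← Finset.sum_mul] using h
  · funext k
    have h := mulVec_column_eq_zero hpsd ((hsum (rowGram p)).trans hfp) k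
    simpa [Matrix.mulVec, dotProduct] using congrFun h i

/-- A framework `(G,p)` in `ℝⁿ` has a nonzero PSD equilibrium stress matrix
iff the edge-length measurement of its Gram matrix lies on the boundary of the cone
`k = π(PSDₙ)`; equivalently, `(G,p)` is liftable to an `(n-1)`-dimensional framework with
full affine span iff it has no nonzero PSD equilibrium stress. -/
theorem stmt5 (n : ℕ) (hn : 1 ≤ n) (G : SimpleGraph (Fin n)) (p : Fin n → Fin n → ℝ) :
    ((∃ Ω : Matrix (Fin n) (Fin n) ℝ, IsNzPSDStressMatrix n G p Ω) ↔
      edgeMeasure n G (gramOf n p) ∈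
        frontier (edgeMeasure n G '' {X : Matrix (Fin n) (Fin n) ℝ | X.PosSemidef})) ∧
    ((∃ pt : Fin n → Fin (n - 1) → ℝ,
        (∀ i j, G.Adj i j → ∑ k, (p i k - p j k) ^ 2 = ∑ k, (pt i k - pt j k) ^ 2) ∧
        affineSpan ℝ (Set.range pt) = ⊤) ↔
      ¬ ∃ Ω : Matrix (Fin n) (Fin n) ℝ, IsNzPSDStressMatrix n G p Ω) := by
  set K := edgeMeasure n G '' {X : Matrix (Fin n) (Fin n) ℝ | X.PosSemidef} with hK
  set x := edgeMeasure n G (gramOf n p) with hx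
  have hxK : x ∈ K := ⟨_, rowGram_posSemidef p, rfl⟩
  have hstress : x ∉ interior K → ∃ Ω, IsNzPSDStressMatrix n G p Ω := by
    intro hxi
    have hconv : Convex ℝ K := by
      rintro _ ⟨X, hX, rfl⟩ _ ⟨Y, hY, rfl⟩ a b ha hb -
      refine ⟨a • X + b • Y, (hX.smul ha).add (hY.smul hb), ?_⟩
      simp only [← edgeMeasureLinear_apply, map_add, map_smul]
    have hcone : ∀ y ∈ K, ∀ t : ℝ, 0 ≤ t → t • y ∈ K := by
      rintro _ ⟨X, hX, rfl⟩ t ht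
      exact ⟨t • X, hX.smul ht, (edgeMeasureLinear n G).map_smul t X⟩
    have := Fintype.ofFinite G.edgeSet
    obtain ⟨f, hf, hfx, hfn⟩ := exists_supporting_functional hconv hcone hxK hxi
    exact exists_stress_of_functional hf hfx fun X hX => hfn _ ⟨X, hX, rfl⟩
  have hlift : x ∈ interior K → ∃ pt : Fin n → Fin (n - 1) → ℝ,
      (∀ i j, G.Adj i j → ∑ k, (p i k - p j k) ^ 2 = ∑ k, (pt i k - pt j k) ^ 2) ∧
        affineSpan ℝ (Set.range pt) = ⊤ := by
    intro hxi
    obtain ⟨X, hX, hXx⟩ := exists_posDef_of_mem_interior hxi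
    obtain ⟨pt, hpt, hspan⟩ := exists_config_of_posDef hn hX
    refine ⟨pt, fun i j hij => ?_, hspan⟩
    rw [← hpt, ← edgeMeasure_mk X hij, hXx, ← rowGram_edge p]
    rfl
  have hno : (∃ pt : Fin n → Fin (n - 1) → ℝ,
      (∀ i j, G.Adj i j → ∑ k, (p i k - p j k) ^ 2 = ∑ k, (pt i k - pt j k) ^ 2) ∧
        affineSpan ℝ (Set.range pt) = ⊤) → ¬ ∃ Ω, IsNzPSDStressMatrix n G p Ω := by
    rintro ⟨pt, hd, hspan⟩ ⟨Ω, hΩ⟩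
    exact not_stress_of_lift hn hd hspan hΩ
  refine ⟨⟨fun h => ⟨subset_closure hxK, fun hxi => hno (hlift hxi) h⟩, fun h => hstress h.2⟩,
    hno, fun h => hlift ?_⟩
  by_contra hxi
  exact h (hstress hxi)
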